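/- arXiv:2006.08990 — 4 statements merged into one kernel-verified Lean document; each statement's English description precedes it below -/
import Mathlib

section
/- The set of tripartite binary correlations admitting a TOBL model across the partition 1|23 is a strict subset of ATOBL_{2←3}; the correlation P^G witnesses the strictness (P^G ∈ ATOBL_{2←3} but P^G ∉ TOBL). -/
open scoped BigOperators

/-- A tripartite binary correlation: `p o1 o2 o3 i1 i2 i3` is the probability of
outputs `(o1,o2,o3)` given inputs `(i1,i2,i3)`, all binary. -/
abbrev TriCorr := Fin 2 → Fin 2 → Fin 2 → Fin 2 → Fin 2 → Fin 2 → ℝ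

/-- `p` is a valid tripartite binary correlation: nonnegative and normalized. -/
def IsTriCorr (p : TriCorr) : Prop :=
  (∀ o1 o2 o3 i1 i2 i3, 0 ≤ p o1 o2 o3 i1 i2 i3) ∧
  (∀ i1 i2 i3, (∑ o1, ∑ o2, ∑ o3, p o1 o2 o3 i1 i2 i3) = 1)

/-- `p` admits a 2←3 asymmetric time-ordered bilocal model across 1|23:
bilocal decomposition whose bipartite terms are no-signaling from party 2 to
party 3 (the marginal `∑ o2, p23 l o2 o3 i2 i3` is independent of `i2`). -/
def ATOBL_left (p : TriCorr) : Prop :=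
  ∃ (n : ℕ) (q : Fin n → ℝ)
    (p1 : Fin n → Fin 2 → Fin 2 → ℝ)
    (p23 : Fin n → Fin 2 → Fin 2 → Fin 2 → Fin 2 → ℝ),
    (∀ l, 0 ≤ q l) ∧ (∑ l, q l) = 1 ∧
    (∀ l o1 i1, 0 ≤ p1 l o1 i1) ∧ (∀ l i1, (∑ o1, p1 l o1 i1) = 1) ∧
    (∀ l o2 o3 i2 i3, 0 ≤ p23 l o2 o3 i2 i3) ∧
    (∀ l i2 i3, (∑ o2, ∑ o3, p23 l o2 o3 i2 i3) = 1) ∧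
    (∀ l o3 i2 i2' i3, (∑ o2, p23 l o2 o3 i2 i3) = ∑ o2, p23 l o2 o3 i2' i3) ∧
    (∀ o1 o2 o3 i1 i2 i3,
      p o1 o2 o3 i1 i2 i3 = ∑ l, q l * p1 l o1 i1 * p23 l o2 o3 i2 i3)

/-- `p` admits a 2→3 asymmetric time-ordered bilocal model across 1|23:
bilocal decomposition whose bipartite terms are no-signaling from party 3 to
party 2 (the marginal `∑ o3, p23 l o2 o3 i2 i3` is independent of `i3`). -/
def ATOBL_right (p : TriCorr) : Prop :=
  ∃ (n : ℕ) (q : Fin n → ℝ)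
    (p1 : Fin n → Fin 2 → Fin 2 → ℝ)
    (p23 : Fin n → Fin 2 → Fin 2 → Fin 2 → Fin 2 → ℝ),
    (∀ l, 0 ≤ q l) ∧ (∑ l, q l) = 1 ∧
    (∀ l o1 i1, 0 ≤ p1 l o1 i1) ∧ (∀ l i1, (∑ o1, p1 l o1 i1) = 1) ∧
    (∀ l o2 o3 i2 i3, 0 ≤ p23 l o2 o3 i2 i3) ∧
    (∀ l i2 i3, (∑ o2, ∑ o3, p23 l o2 o3 i2 i3) = 1) ∧
    (∀ l o2 i2 i3 i3', (∑ o3, p23 l o2 o3 i2 i3) = ∑ o3, p23 l o2 o3 i2 i3') ∧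
    (∀ o1 o2 o3 i1 i2 i3,
      p o1 o2 o3 i1 i2 i3 = ∑ l, q l * p1 l o1 i1 * p23 l o2 o3 i2 i3)

/-- The Gallego et al. GHZ correlation `P^G`. -/
noncomputable def pG : TriCorr := fun o1 o2 o3 i1 i2 i3 =>
  (1 / 8) * (1
    + (-1 : ℝ) ^ (o1.val + o2.val) * (if i1 = 0 then 1 else 0) * (if i2 = 0 then 1 else 0)
    + (1 / Real.sqrt 2) * (-1 : ℝ) ^ (o1.val + o3.val) * (if i1 = 0 then 1 else 0)
    + (1 / Real.sqrt 2) * (-1 : ℝ) ^ (o2.val + o3.val) * (if i2 = 0 then 1 else 0)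
    + (1 / Real.sqrt 2) * (-1 : ℝ) ^ (i3.val + o1.val + o2.val + o3.val)
        * (if i1 = 1 then 1 else 0) * (if i2 = 1 then 1 else 0))

set_option maxHeartbeats 1000000 in
theorem ATOBL_left_pG : ATOBL_left pG := by
  have hr : 0 ≤ 1 / Real.sqrt 2 ∧ 1 / Real.sqrt 2 ≤ 1 :=
    ⟨by positivity, (div_le_one (by positivity)).2 (Real.one_le_sqrt.2 (by norm_num))⟩
  unfold ATOBL_left pG
  generalize 1 / Real.sqrt 2 = r at hr ⊢
  have hs (m : ℕ) : 0 ≤ (1 + (-1 : ℝ) ^ m * r) / 2 := by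
    rcases neg_one_pow_eq_or ℝ m with h | h <;> rw [h] <;> linarith [hr.1, hr.2]
  refine ⟨4, fun _ => 1 / 4,
    fun l o1 i1 => if o1.val = (if i1 = 0 then l.val / 2 else l.val % 2) then 1 else 0,
    fun l o2 o3 i2 i3 => (1 + (-1) ^ (l.val / 2 + o3.val) * r) / 2 *
      if i2 = 0 then (if o2.val = l.val / 2 then 1 else 0)
      else (1 + (-1) ^ (i3.val + l.val % 2 + o2.val + o3.val) * r) / 2,
    fun _ => by norm_num, by norm_num, fun l o1 i1 => by positivity, ?_,
    fun l o2 o3 i2 i3 => mul_nonneg (hs _) ?_, ?_, ?_, ?_⟩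
  · intro l i1
    rw [Fin.sum_univ_two]
    fin_cases l <;> fin_cases i1 <;> simp
  · split_ifs
    exacts [zero_le_one, le_rfl, hs _]
  · intro l i2 i3
    fin_cases l <;> fin_cases i2 <;> fin_cases i3 <;> simp [Fin.sum_univ_two] <;> ring
  · intro l o3 i2 i2' i3
    fin_cases l <;> fin_cases i2 <;> fin_cases i2' <;> fin_cases i3 <;>
      simp [Fin.sum_univ_two] <;> ring
  · intro o1 o2 o3 i1 i2 i3
    fin_cases i1 <;> fin_cases i2 <;> fin_cases i3 <;> fin_cases o1 <;> fin_cases o2 <;>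
      fin_cases o3 <;> simp [Fin.sum_univ_four] <;> ring

/-- The linear functional `⟨a₀ c₀⟩ + ⟨a₀ c₁⟩ + ⟨a₁ b c₀⟩ - ⟨a₁ b c₁⟩` of a tripartite correlation,
where the second party always receives the input `1`. -/
def chshFunctional (p : TriCorr) : ℝ :=
  ∑ o1 : Fin 2, ∑ o2 : Fin 2, ∑ o3 : Fin 2,
    ((-1) ^ (o1.val + o3.val) * (p o1 o2 o3 0 1 0 + p o1 o2 o3 0 1 1)
      + (-1) ^ (o1.val + o2.val + o3.val) * (p o1 o2 o3 1 1 0 - p o1 o2 o3 1 1 1))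

theorem chshFunctional_sum {n : ℕ} (q : Fin n → ℝ) (P : Fin n → TriCorr) :
    chshFunctional (fun o1 o2 o3 i1 i2 i3 => ∑ l, q l * P l o1 o2 o3 i1 i2 i3) =
      ∑ l, q l * chshFunctional (P l) := by
  simp only [chshFunctional, Fin.sum_univ_two, Finset.mul_sum, ← Finset.sum_add_distrib,
    ← Finset.sum_sub_distrib]
  exact Finset.sum_congr rfl fun l _ => by ring

theorem mul_add_mul_le_abs_add_abs {a b x y : ℝ} (ha : |a| ≤ 1) (hb : |b| ≤ 1) :
    a * x + b * y ≤ |x| + |y| := by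
  have hx := mul_le_of_le_one_left (abs_nonneg x) ha
  have hy := mul_le_of_le_one_left (abs_nonneg y) hb
  rw [← abs_mul] at hx hy
  linarith [le_abs_self (a * x), le_abs_self (b * y)]

theorem chshFunctional_product_le_two (f : Fin 2 → Fin 2 → ℝ)
    (g : Fin 2 → Fin 2 → Fin 2 → Fin 2 → ℝ)
    (hf : ∀ o1 i1, 0 ≤ f o1 i1) (hf_sum : ∀ i1, ∑ o1, f o1 i1 = 1)
    (hg : ∀ o2 o3 i2 i3, 0 ≤ g o2 o3 i2 i3) (hg_sum : ∀ i2 i3, ∑ o2, ∑ o3, g o2 o3 i2 i3 = 1)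
    (hns : ∀ o2 i2 i3 i3', ∑ o3, g o2 o3 i2 i3 = ∑ o3, g o2 o3 i2 i3') :
    chshFunctional (fun o1 o2 o3 i1 i2 i3 => f o1 i1 * g o2 o3 i2 i3) ≤ 2 := by
  simp only [Fin.sum_univ_two] at hf_sum hg_sum hns
  have hbias (i : Fin 2) : |f 0 i - f 1 i| ≤ 1 := by
    rw [abs_le]
    constructor <;> linarith [hf 0 i, hf 1 i, hf_sum i]
  set x : ℝ := (g 0 0 1 0 - g 0 1 1 0 + g 1 0 1 0 - g 1 1 1 0)
    + (g 0 0 1 1 - g 0 1 1 1 + g 1 0 1 1 - g 1 1 1 1) with hx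
  set y : ℝ := (g 0 0 1 0 - g 0 1 1 0 - g 1 0 1 0 + g 1 1 1 0)
    - (g 0 0 1 1 - g 0 1 1 1 - g 1 0 1 1 + g 1 1 1 1) with hy
  have hxy : |x| + |y| ≤ 2 := by
    have h0 := hns 0 1 0 1
    have h1 := hns 1 1 0 1
    have hs := hg_sum 1 0
    rcases abs_cases x with ⟨ex, -⟩ | ⟨ex, -⟩ <;> rcases abs_cases y with ⟨ey, -⟩ | ⟨ey, -⟩ <;>
      rw [ex, ey] <;>
      linarith [hg 0 0 1 0, hg 0 0 1 1, hg 0 1 1 0, hg 0 1 1 1, hg 1 0 1 0, hg 1 0 1 1,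
        hg 1 1 1 0, hg 1 1 1 1]
  calc chshFunctional (fun o1 o2 o3 i1 i2 i3 => f o1 i1 * g o2 o3 i2 i3)
      = (f 0 0 - f 1 0) * x + (f 0 1 - f 1 1) * y := by
        simp [chshFunctional, Fin.sum_univ_two, hx, hy]
        ring
    _ ≤ |x| + |y| := mul_add_mul_le_abs_add_abs (hbias 0) (hbias 1)
    _ ≤ 2 := hxy

theorem ATOBL_right.chshFunctional_le_two {p : TriCorr} (hp : ATOBL_right p) :
    chshFunctional p ≤ 2 := by
  obtain ⟨n, q, f, g, hq, hq_sum, hf, hf_sum, hg, hg_sum, hns, h⟩ := hp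
  have hp_eq : p = fun o1 o2 o3 i1 i2 i3 => ∑ l, q l * (f l o1 i1 * g l o2 o3 i2 i3) := by
    funext o1 o2 o3 i1 i2 i3
    simp only [h, mul_assoc]
  rw [hp_eq, chshFunctional_sum q fun l o1 o2 o3 i1 i2 i3 => f l o1 i1 * g l o2 o3 i2 i3]
  calc _ ≤ ∑ l, q l * 2 := Finset.sum_le_sum fun l _ => mul_le_mul_of_nonneg_left
        (chshFunctional_product_le_two _ _ (hf l) (hf_sum l) (hg l) (hg_sum l) (hns l)) (hq l)
    _ = 2 := by rw [← Finset.sum_mul, hq_sum, one_mul]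

theorem chshFunctional_pG : chshFunctional pG = 4 * (1 / Real.sqrt 2) := by
  unfold chshFunctional pG
  generalize 1 / Real.sqrt 2 = r
  simp [Fin.sum_univ_two]
  ring

theorem not_ATOBL_right_pG : ¬ ATOBL_right pG := by
  intro h
  have hle := h.chshFunctional_le_two
  have hlt : Real.sqrt 2 < 2 := (Real.sqrt_lt' (by norm_num)).2 (by norm_num)
  have hgt : 1 / 2 < 1 / Real.sqrt 2 := one_div_lt_one_div_of_lt (by positivity) hlt
  rw [chshFunctional_pG] at hle
  linarith

/-- TOBL is a strict subset of `ATOBL_{2←3}`, witnessed by `P^G`. -/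
theorem TOBL_ssubset_ATOBL_left :
    {p : TriCorr | ATOBL_left p ∧ ATOBL_right p} ⊂ {p : TriCorr | ATOBL_left p} ∧
    ATOBL_left pG ∧ ¬ (ATOBL_left pG ∧ ATOBL_right pG) :=
  ⟨⟨fun _ hp => hp.1, fun h => not_ATOBL_right_pG (h ATOBL_left_pG).2⟩,
    ATOBL_left_pG, fun h => not_ATOBL_right_pG h.2⟩
end

section
/- For every ε ∈ [0,1], the correlation P^ε_{2→3}, defined by P^ε_{2→3}(o₁o₂o₃|i₁i₂i₃) := P^ε_{2←3}(o₁o₃o₂|i₁i₃i₂), belongs to ATOBL_{2→3}. -/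
open scoped BigOperators

/-- The correlation `P^ε_{2←3}` of Dutta–Mukherjee–Banik. -/
noncomputable def pEpsL (ε : ℝ) : TriCorr := fun o1 o2 o3 i1 i2 i3 =>
  (1 / 8) * (1
    + (-1 : ℝ) ^ (o1.val + o2.val) * (if i1 = 0 then 1 else 0) * (if i2 = 0 then 1 else 0)
    + ε * (-1 : ℝ) ^ (o1.val + o3.val) * (if i1 = 0 then 1 else 0)
    + ε * (-1 : ℝ) ^ (o2.val + o3.val) * (if i2 = 0 then 1 else 0)
    + ε * (-1 : ℝ) ^ (i3.val + o1.val + o2.val + o3.val)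
        * (if i1 = 1 then 1 else 0) * (if i2 = 1 then 1 else 0))

/-- The correlation `P^ε_{2→3}`, obtained from `P^ε_{2←3}` by swapping parties 2 and 3. -/
noncomputable def pEpsR (ε : ℝ) : TriCorr := fun o1 o2 o3 i1 i2 i3 =>
  pEpsL ε o1 o3 o2 i1 i3 i2

/-- The deterministic `±1` response of party 1 to the input `i` under the strategy `l`,
which ranges over all four pairs of responses. -/
def signResponse (l : Fin 4) (i : Fin 2) : ℝ :=
  (-1) ^ (if i = 0 then l.val / 2 else l.val % 2)

/-- The `±1` value of a binary outcome. -/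
def outcomeSign (o : Fin 2) : ℝ := (-1) ^ o.val

/-- The response of party 1 under the strategy `l`. -/
noncomputable def responseOne (l : Fin 4) (o i : Fin 2) : ℝ :=
  (1 + outcomeSign o * signResponse l i) / 2

/-- Party 2 outputs party 1's response to input `0` with bias `ε`. Party 3 then outputs that
response on input `0`, and on input `1` uses party 2's input and output to correlate, with
bias `ε`, with party 1's response to input `1`. -/
noncomputable def responseTwoThree (ε : ℝ) (l : Fin 4) (o₂ o₃ i₂ i₃ : Fin 2) : ℝ :=
  (1 + ε * (outcomeSign o₂ * signResponse l 0)) / 2 *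
    ((1 + (if i₃ = 0 then 1 else ε) * (outcomeSign o₃ *
      (if i₃ = 0 then signResponse l 0
        else signResponse l 1 * outcomeSign o₂ * outcomeSign i₂))) / 2)

lemma signResponse_eq_or (l : Fin 4) (i : Fin 2) :
    signResponse l i = 1 ∨ signResponse l i = -1 :=
  neg_one_pow_eq_or ℝ _

lemma outcomeSign_eq_or (o : Fin 2) : outcomeSign o = 1 ∨ outcomeSign o = -1 :=
  neg_one_pow_eq_or ℝ _

lemma responseOne_nonneg (l : Fin 4) (o i : Fin 2) : 0 ≤ responseOne l o i := by
  unfold responseOne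
  rcases outcomeSign_eq_or o with h | h <;> rcases signResponse_eq_or l i with h' | h' <;>
    norm_num [h, h']

lemma sum_responseOne (l : Fin 4) (i : Fin 2) : ∑ o, responseOne l o i = 1 := by
  simp [responseOne, outcomeSign, Fin.sum_univ_two]
  ring

lemma responseTwoThree_nonneg {ε : ℝ} (h0 : 0 ≤ ε) (h1 : ε ≤ 1) (l : Fin 4)
    (o₂ o₃ i₂ i₃ : Fin 2) : 0 ≤ responseTwoThree ε l o₂ o₃ i₂ i₃ := by
  unfold responseTwoThree
  apply mul_nonneg
  · rcases outcomeSign_eq_or o₂ with h | h <;> rcases signResponse_eq_or l 0 with h' | h' <;>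
      rw [h, h'] <;> linarith
  · split_ifs
    · rcases outcomeSign_eq_or o₃ with h | h <;> rcases signResponse_eq_or l 0 with h' | h' <;>
        norm_num [h, h']
    · rcases outcomeSign_eq_or o₃ with h | h <;> rcases signResponse_eq_or l 1 with h' | h' <;>
        rcases outcomeSign_eq_or o₂ with k | k <;> rcases outcomeSign_eq_or i₂ with k' | k' <;>
        rw [h, h', k, k'] <;> linarith

lemma sum_responseTwoThree (ε : ℝ) (l : Fin 4) (o₂ i₂ i₃ : Fin 2) :
    ∑ o₃, responseTwoThree ε l o₂ o₃ i₂ i₃ =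
      (1 + ε * (outcomeSign o₂ * signResponse l 0)) / 2 := by
  have h0 : outcomeSign 0 = 1 := by simp [outcomeSign]
  have h1 : outcomeSign 1 = -1 := by simp [outcomeSign]
  simp only [responseTwoThree, Fin.sum_univ_two, h0, h1]
  ring

lemma pEpsR_eq_sum (ε : ℝ) (o₁ o₂ o₃ i₁ i₂ i₃ : Fin 2) :
    pEpsR ε o₁ o₂ o₃ i₁ i₂ i₃ =
      ∑ l, 1 / 4 * responseOne l o₁ i₁ * responseTwoThree ε l o₂ o₃ i₂ i₃ := by
  simp only [pEpsR, pEpsL, responseOne, responseTwoThree, Fin.sum_univ_four, signResponse,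
    pow_add, ← outcomeSign.eq_1]
  fin_cases i₁ <;> fin_cases i₃ <;> simp <;> grind

/-- For every `ε ∈ [0,1]`, `P^ε_{2→3} ∈ ATOBL_{2→3}`. -/
theorem pEpsR_mem_ATOBL_right (ε : ℝ) (hε : ε ∈ Set.Icc (0 : ℝ) 1) :
    ATOBL_right (pEpsR ε) := by
  refine ⟨4, fun _ => 1 / 4, responseOne, responseTwoThree ε, fun _ => by norm_num,
    by norm_num, responseOne_nonneg, sum_responseOne, responseTwoThree_nonneg hε.1 hε.2,
    fun l i₂ i₃ => ?_, fun l o₂ i₂ i₃ i₃' => ?_, pEpsR_eq_sum ε⟩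
  · simp only [sum_responseTwoThree]
    simp [outcomeSign, Fin.sum_univ_two]
    ring
  · simp only [sum_responseTwoThree]
end

section
/- For every ε ∈ (3/4, 1], the 2→3 wiring of P^ε_{1/2}, i.e. the bipartite binary correlation Q(o₁o₃|i₁i₂) := Σ_{o₂} P^ε_{1/2}(o₁o₂o₃|i₁, i₂, i₃=o₂), is not local: it admits no decomposition Q(ab|xy) = Σ_λ q(λ)·q₁(a|x,λ)·q₂(b|y,λ) with a finite set Λ, weights q(λ) ≥ 0 summing to 1, and nonnegative output-normalized distributions q₁, q₂. -/
open scoped BigOperators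

/-- A bipartite binary correlation `Q a b x y` is local: it admits an LHV
decomposition with a finite hidden variable. -/
def IsLocal (Q : Fin 2 → Fin 2 → Fin 2 → Fin 2 → ℝ) : Prop :=
  ∃ (n : ℕ) (q : Fin n → ℝ) (q1 q2 : Fin n → Fin 2 → Fin 2 → ℝ),
    (∀ l, 0 ≤ q l) ∧ (∑ l, q l) = 1 ∧
    (∀ l a x, 0 ≤ q1 l a x) ∧ (∀ l x, (∑ a, q1 l a x) = 1) ∧
    (∀ l b y, 0 ≤ q2 l b y) ∧ (∀ l y, (∑ b, q2 l b y) = 1) ∧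
    (∀ a b x y, Q a b x y = ∑ l, q l * q1 l a x * q2 l b y)

/-- The convex mixture `P^ε_α = α P^ε_{2←3} + (1-α) P^ε_{2→3}`. -/
noncomputable def pEpsAlpha (ε α : ℝ) : TriCorr := fun o1 o2 o3 i1 i2 i3 =>
  α * pEpsL ε o1 o2 o3 i1 i2 i3 + (1 - α) * pEpsR ε o1 o2 o3 i1 i2 i3

/-- The correlator `⟨(-1)^(a+b)⟩` of a bipartite binary correlation at inputs `x`, `y`. -/
def correlator (Q : Fin 2 → Fin 2 → Fin 2 → Fin 2 → ℝ) (x y : Fin 2) : ℝ :=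
  Q 0 0 x y - Q 0 1 x y - Q 1 0 x y + Q 1 1 x y

lemma chsh_le_two_of_abs_le_one {a₀ a₁ b₀ b₁ : ℝ} (ha₀ : |a₀| ≤ 1) (ha₁ : |a₁| ≤ 1)
    (hb₀ : |b₀| ≤ 1) (hb₁ : |b₁| ≤ 1) :
    a₀ * b₀ + a₀ * b₁ - a₁ * b₀ + a₁ * b₁ ≤ 2 := by
  have h₀ : a₀ * (b₀ + b₁) ≤ |b₀ + b₁| := by
    refine (le_abs_self _).trans ?_
    rw [abs_mul]
    exact mul_le_of_le_one_left (abs_nonneg _) ha₀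
  have h₁ : a₁ * (b₁ - b₀) ≤ |b₁ - b₀| := by
    refine (le_abs_self _).trans ?_
    rw [abs_mul]
    exact mul_le_of_le_one_left (abs_nonneg _) ha₁
  have h : |b₀ + b₁| + |b₁ - b₀| ≤ 2 := by
    rw [abs_le] at hb₀ hb₁
    rcases abs_cases (b₀ + b₁) with h | h <;> rcases abs_cases (b₁ - b₀) with h' | h' <;>
      linarith
  linarith

lemma abs_sub_le_one_of_add_eq_one {u v : ℝ} (hu : 0 ≤ u) (hv : 0 ≤ v) (h : u + v = 1) :
    |u - v| ≤ 1 :=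
  abs_le.2 ⟨by linarith, by linarith⟩

/-- The CHSH inequality. -/
theorem IsLocal.chsh_le_two {Q : Fin 2 → Fin 2 → Fin 2 → Fin 2 → ℝ} (hQ : IsLocal Q) :
    correlator Q 0 0 + correlator Q 0 1 - correlator Q 1 0 + correlator Q 1 1 ≤ 2 := by
  obtain ⟨n, q, q1, q2, hq, hsum, h1, h1s, h2, h2s, hdec⟩ := hQ
  have hA (l : Fin n) (x : Fin 2) : |q1 l 0 x - q1 l 1 x| ≤ 1 :=
    abs_sub_le_one_of_add_eq_one (h1 l 0 x) (h1 l 1 x) (by simpa using h1s l x)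
  have hB (l : Fin n) (y : Fin 2) : |q2 l 0 y - q2 l 1 y| ≤ 1 :=
    abs_sub_le_one_of_add_eq_one (h2 l 0 y) (h2 l 1 y) (by simpa using h2s l y)
  have hcorr (x y : Fin 2) : correlator Q x y =
      ∑ l, q l * ((q1 l 0 x - q1 l 1 x) * (q2 l 0 y - q2 l 1 y)) := by
    simp only [correlator, hdec, ← Finset.sum_add_distrib, ← Finset.sum_sub_distrib]
    exact Finset.sum_congr rfl fun l _ => by ring
  simp only [hcorr, ← Finset.sum_add_distrib, ← Finset.sum_sub_distrib]
  calc _ ≤ ∑ l, q l * 2 := Finset.sum_le_sum fun l _ => by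
        simpa only [mul_add, mul_sub] using mul_le_mul_of_nonneg_left
          (chsh_le_two_of_abs_le_one (hA l 0) (hA l 1) (hB l 0) (hB l 1)) (hq l)
    _ = 2 := by rw [← Finset.sum_mul, hsum, one_mul]

lemma chsh_wiring_pEpsHalf (ε : ℝ) :
    let Q := fun o1 o3 i1 i2 => ∑ o2, pEpsAlpha ε (1 / 2) o1 o2 o3 i1 i2 o2
    correlator Q 0 0 + correlator Q 0 1 - correlator Q 1 0 + correlator Q 1 1
      = 2 * ε + 1 / 2 := by
  simp [correlator, pEpsAlpha, pEpsL, pEpsR, Fin.sum_univ_two]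
  ring

/-- For `ε ∈ (3/4, 1]`, the 2→3 wiring of `P^ε_{1/2}` is not local. -/
theorem pEpsHalf_wiring_not_local (ε : ℝ) (hε : ε ∈ Set.Ioc (3 / 4 : ℝ) 1) :
    ¬ IsLocal (fun o1 o3 i1 i2 => ∑ o2, pEpsAlpha ε (1 / 2) o1 o2 o3 i1 i2 o2) := by
  intro hQ
  have h := hQ.chsh_le_two
  rw [chsh_wiring_pEpsHalf] at h
  linarith [hε.1]
end

section
/- Within the space of tripartite binary correlations, the union ATOBL_{2←3} ∪ ATOBL_{2→3} is a strict subset of its convex hull ATOBL := convexHull(ATOBL_{2←3} ∪ ATOBL_{2→3}); the correlations P^ε_{1/2} for ε ∈ (3/4, 1] lie in ATOBL but not in the union. -/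
open scoped BigOperators

/-- Exchange of parties 2 and 3. -/
def TriCorr.swap (p : TriCorr) : TriCorr := fun o1 o2 o3 i1 i2 i3 => p o1 o3 o2 i1 i3 i2

lemma ATOBL_right.swap {p : TriCorr} (h : ATOBL_right p) : ATOBL_left p.swap := by
  obtain ⟨n, q, p1, p23, hq, hq1, hp1, hp1s, hp23, hp23s, hns, hp⟩ := h
  refine ⟨n, q, p1, fun l o2 o3 i2 i3 => p23 l o3 o2 i3 i2, hq, hq1, hp1, hp1s,
    fun l o2 o3 i2 i3 => hp23 l o3 o2 i3 i2, fun l i2 i3 => ?_,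
    fun l o3 i2 i2' i3 => hns l o3 i3 i2 i2', fun o1 o2 o3 i1 i2 i3 => hp o1 o3 o2 i1 i3 i2⟩
  rw [Finset.sum_comm]
  exact hp23s l i3 i2

lemma ATOBL_left.swap {p : TriCorr} (h : ATOBL_left p) : ATOBL_right p.swap := by
  obtain ⟨n, q, p1, p23, hq, hq1, hp1, hp1s, hp23, hp23s, hns, hp⟩ := h
  refine ⟨n, q, p1, fun l o2 o3 i2 i3 => p23 l o3 o2 i3 i2, hq, hq1, hp1, hp1s,
    fun l o2 o3 i2 i3 => hp23 l o3 o2 i3 i2, fun l i2 i3 => ?_,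
    fun l o2 i2 i3 i3' => hns l o2 i3 i3' i2, fun o1 o2 o3 i1 i2 i3 => hp o1 o3 o2 i1 i3 i2⟩
  rw [Finset.sum_comm]
  exact hp23s l i3 i2

lemma pEpsAlpha_half_swap (ε : ℝ) : (pEpsAlpha ε (1 / 2)).swap = pEpsAlpha ε (1 / 2) := by
  funext o1 o2 o3 i1 i2 i3
  simp only [TriCorr.swap, pEpsAlpha, pEpsR]
  ring

/-- The sign `(-1) ^ o` of an output bit. -/
def bitSign (o : Fin 2) : ℝ := (-1) ^ o.val

lemma bitSign_zero : bitSign 0 = 1 := by simp [bitSign]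

lemma bitSign_one : bitSign 1 = -1 := by simp [bitSign]

lemma bitSign_mem (o : Fin 2) : bitSign o = 1 ∨ bitSign o = -1 := by
  fin_cases o
  · exact Or.inl bitSign_zero
  · exact Or.inr bitSign_one

/-- The CHSH expression with third input `1`, in which party 1's second observable is multiplied
by the output bitSign of party 3. -/
def chsh (p : TriCorr) : ℝ :=
  ∑ o1, ∑ o2, ∑ o3, (bitSign o1 * bitSign o2 * (p o1 o2 o3 0 0 1 + p o1 o2 o3 0 1 1)
    + bitSign o1 * bitSign o2 * bitSign o3 * (p o1 o2 o3 1 0 1 - p o1 o2 o3 1 1 1))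

lemma chsh_sum {n : ℕ} (q : Fin n → ℝ) (P : Fin n → TriCorr) :
    chsh (fun o1 o2 o3 i1 i2 i3 => ∑ l, q l * P l o1 o2 o3 i1 i2 i3) =
      ∑ l, q l * chsh (P l) := by
  simp only [chsh, Fin.sum_univ_two, Finset.mul_sum, mul_add, mul_sub, Finset.sum_add_distrib,
    Finset.sum_sub_distrib, mul_left_comm (q _)]

lemma mul_add_add_mul_sub_le {s t x y m : ℝ} (hs : |s| ≤ 1) (ht : |t| ≤ 1) (hx : |x| ≤ m)
    (hy : |y| ≤ m) : s * (x + y) + t * (x - y) ≤ 2 * m := by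
  have h1 : s * (x + y) ≤ |x + y| := (le_abs_self _).trans <| by
    rw [abs_mul]; exact mul_le_of_le_one_left (abs_nonneg _) hs
  have h2 : t * (x - y) ≤ |x - y| := (le_abs_self _).trans <| by
    rw [abs_mul]; exact mul_le_of_le_one_left (abs_nonneg _) ht
  rw [abs_le] at hx hy
  cases abs_cases (x + y) <;> cases abs_cases (x - y) <;> linarith

/-- The CHSH bound for a product of a distribution of party 1 with a distribution of parties 2
and 3 in which party 2 does not signal to party 3. -/
lemma chsh_prod_le_two {a : Fin 2 → Fin 2 → ℝ} {b : Fin 2 → Fin 2 → Fin 2 → Fin 2 → ℝ}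
    (ha : ∀ o i, 0 ≤ a o i) (ha1 : ∀ i, ∑ o, a o i = 1)
    (hb : ∀ o2 o3 i2 i3, 0 ≤ b o2 o3 i2 i3)
    (hb1 : ∀ i2 i3, ∑ o2, ∑ o3, b o2 o3 i2 i3 = 1)
    (hns : ∀ o3 i2 i2' i3, ∑ o2, b o2 o3 i2 i3 = ∑ o2, b o2 o3 i2' i3) :
    chsh (fun o1 o2 o3 i1 i2 i3 => a o1 i1 * b o2 o3 i2 i3) ≤ 2 := by
  simp only [Fin.sum_univ_two] at ha1 hb1 hns
  have hA (i) : |a 0 i - a 1 i| ≤ 1 := by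
    rw [abs_le]; constructor <;> linarith [ha 0 i, ha 1 i, ha1 i]
  have hA' (i) : |-(a 0 i - a 1 i)| ≤ 1 := by rw [abs_neg]; exact hA i
  have hB (c i) : |b 0 c i 1 - b 1 c i 1| ≤ b 0 c 0 1 + b 1 c 0 1 := by
    rw [abs_le]; constructor <;> linarith [hb 0 c i 1, hb 1 c i 1, hns c i 0 1]
  have h0 := mul_add_add_mul_sub_le (hA 0) (hA 1) (hB 0 0) (hB 0 1)
  have h1 := mul_add_add_mul_sub_le (hA 0) (hA' 1) (hB 1 0) (hB 1 1)
  simp only [chsh, Fin.sum_univ_two, bitSign_zero, bitSign_one]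
  linarith [hb1 0 1]

lemma ATOBL_left.chsh_le_two {p : TriCorr} (h : ATOBL_left p) : chsh p ≤ 2 := by
  obtain ⟨n, q, p1, p23, hq, hq1, hp1, hp1s, hp23, hp23s, hns, hp⟩ := h
  have hp' : p = fun o1 o2 o3 i1 i2 i3 => ∑ l, q l *
      (fun o1 o2 o3 i1 i2 i3 => p1 l o1 i1 * p23 l o2 o3 i2 i3 : TriCorr) o1 o2 o3 i1 i2 i3 := by
    funext o1 o2 o3 i1 i2 i3
    simp only [hp, mul_assoc]
  rw [hp', chsh_sum]
  calc _ ≤ ∑ l, q l * 2 := Finset.sum_le_sum fun l _ => mul_le_mul_of_nonneg_left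
        (chsh_prod_le_two (hp1 l) (hp1s l) (hp23 l) (hp23s l) (hns l)) (hq l)
    _ = 2 := by rw [← Finset.sum_mul, hq1, one_mul]

lemma chsh_pEpsAlpha_half (ε : ℝ) : chsh (pEpsAlpha ε (1 / 2)) = 1 / 2 + 5 / 2 * ε := by
  simp [chsh, Fin.sum_univ_two, bitSign_zero, bitSign_one, pEpsAlpha, pEpsR, pEpsL]
  ring

lemma not_ATOBL_left_pEpsAlpha_half {ε : ℝ} (hε : 3 / 5 < ε) :
    ¬ ATOBL_left (pEpsAlpha ε (1 / 2)) := fun h => by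
  have := h.chsh_le_two
  rw [chsh_pEpsAlpha_half] at this
  linarith

lemma not_ATOBL_right_pEpsAlpha_half {ε : ℝ} (hε : 3 / 5 < ε) :
    ¬ ATOBL_right (pEpsAlpha ε (1 / 2)) := fun h =>
  not_ATOBL_left_pEpsAlpha_half hε (pEpsAlpha_half_swap ε ▸ h.swap)

/-- The distribution of party 1 in a model of `pEpsL`: the hidden variable consists of the
predetermined outputs `a 0`, `a 1`. -/
noncomputable def modelOne (a : Fin 2 → Fin 2) (o1 i1 : Fin 2) : ℝ :=
  (1 + bitSign o1 * bitSign (a i1)) / 2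

/-- The distribution of parties 2 and 3 in a model of `pEpsL`: party 3 outputs a noisy copy of
`a 0`, and party 2 outputs `a 0` or a noisy copy of `a 1 + o3 + i3` according to its input. -/
noncomputable def modelTwoThree (ε : ℝ) (a : Fin 2 → Fin 2) (o2 o3 i2 i3 : Fin 2) : ℝ :=
  (1 + ε * (bitSign o3 * bitSign (a 0))) / 2 *
    if i2 = 0 then (1 + bitSign o2 * bitSign (a 0)) / 2
    else (1 + ε * (bitSign o2 * bitSign (a 1) * bitSign o3 * bitSign i3)) / 2

lemma ATOBL_left_pEpsL {ε : ℝ} (h0 : 0 ≤ ε) (h1 : ε ≤ 1) : ATOBL_left (pEpsL ε) := by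
  let a (l : Fin 4) : Fin 2 → Fin 2 := ![![0, 0, 1, 1] l, ![0, 1, 0, 1] l]
  have hs (s : ℝ) (h : s = 1 ∨ s = -1) : 0 ≤ (1 + ε * s) / 2 := by
    rcases h with rfl | rfl <;> linarith
  have hs' (s : ℝ) (h : s = 1 ∨ s = -1) : 0 ≤ (1 + s) / 2 := by
    rcases h with rfl | rfl <;> norm_num
  have hmul {s t : ℝ} (h : s = 1 ∨ s = -1) (h' : t = 1 ∨ t = -1) : s * t = 1 ∨ s * t = -1 := by
    rcases h with rfl | rfl <;> rcases h' with rfl | rfl <;> norm_num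
  refine ⟨4, fun _ => 1 / 4, fun l => modelOne (a l), fun l => modelTwoThree ε (a l),
    fun _ => by norm_num, by norm_num, fun l o1 i1 => hs' _ (hmul (bitSign_mem _) (bitSign_mem _)),
    fun l i1 => ?_, fun l o2 o3 i2 i3 => mul_nonneg (hs _ (hmul (bitSign_mem _) (bitSign_mem _))) ?_,
    fun l i2 i3 => ?_, fun l o3 i2 i2' i3 => ?_, fun o1 o2 o3 i1 i2 i3 => ?_⟩
  · simp only [modelOne, Fin.sum_univ_two, bitSign_zero, bitSign_one]
    ring
  · split_ifs
    · exact hs' _ (hmul (bitSign_mem _) (bitSign_mem _))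
    · exact hs _ (hmul (hmul (hmul (bitSign_mem _) (bitSign_mem _)) (bitSign_mem _)) (bitSign_mem _))
  · simp only [modelTwoThree, Fin.sum_univ_two, bitSign_zero, bitSign_one]
    split_ifs <;> ring
  · simp only [modelTwoThree, Fin.sum_univ_two, bitSign_zero, bitSign_one]
    split_ifs <;> ring
  · have e : pEpsL ε o1 o2 o3 i1 i2 i3 = (1 / 8) * (1
        + bitSign o1 * bitSign o2 * (if i1 = 0 then 1 else 0) * (if i2 = 0 then 1 else 0)
        + ε * (bitSign o1 * bitSign o3) * (if i1 = 0 then 1 else 0)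
        + ε * (bitSign o2 * bitSign o3) * (if i2 = 0 then 1 else 0)
        + ε * (bitSign i3 * bitSign o1 * bitSign o2 * bitSign o3)
          * (if i1 = 1 then 1 else 0) * (if i2 = 1 then 1 else 0)) := by
      simp only [pEpsL, bitSign, pow_add]
    rw [e]
    fin_cases i1 <;> fin_cases i2 <;>
      simp [Fin.sum_univ_four, modelOne, modelTwoThree, a, bitSign_zero, bitSign_one] <;>
      ring

lemma ATOBL_right_pEpsR {ε : ℝ} (h0 : 0 ≤ ε) (h1 : ε ≤ 1) : ATOBL_right (pEpsR ε) :=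
  (ATOBL_left_pEpsL h0 h1).swap

lemma pEpsAlpha_half_mem_convexHull {ε : ℝ} (h0 : 0 ≤ ε) (h1 : ε ≤ 1) :
    pEpsAlpha ε (1 / 2)
      ∈ convexHull ℝ ({p : TriCorr | ATOBL_left p} ∪ {p : TriCorr | ATOBL_right p}) := by
  have h := convex_convexHull ℝ ({p : TriCorr | ATOBL_left p} ∪ {p : TriCorr | ATOBL_right p})
    (subset_convexHull ℝ _ (Or.inl (ATOBL_left_pEpsL h0 h1)))
    (subset_convexHull ℝ _ (Or.inr (ATOBL_right_pEpsR h0 h1)))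
    (a := 1 / 2) (b := 1 - 1 / 2) (by norm_num) (by norm_num) (by norm_num)
  exact h

/-- The union `ATOBL_{2←3} ∪ ATOBL_{2→3}` is a strict subset of its convex hull,
the correlations `P^ε_{1/2}` for `ε ∈ (3/4, 1]` witnessing strictness. -/
theorem union_ssubset_convexHull :
    ({p : TriCorr | ATOBL_left p} ∪ {p : TriCorr | ATOBL_right p})
      ⊂ convexHull ℝ ({p : TriCorr | ATOBL_left p} ∪ {p : TriCorr | ATOBL_right p}) ∧
    ∀ ε : ℝ, ε ∈ Set.Ioc (3 / 4 : ℝ) 1 →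
      pEpsAlpha ε (1 / 2)
          ∈ convexHull ℝ ({p : TriCorr | ATOBL_left p} ∪ {p : TriCorr | ATOBL_right p}) ∧
      pEpsAlpha ε (1 / 2)
          ∉ ({p : TriCorr | ATOBL_left p} ∪ {p : TriCorr | ATOBL_right p}) := by
  have key : ∀ ε : ℝ, ε ∈ Set.Ioc (3 / 4 : ℝ) 1 →
      pEpsAlpha ε (1 / 2)
          ∈ convexHull ℝ ({p : TriCorr | ATOBL_left p} ∪ {p : TriCorr | ATOBL_right p}) ∧
      pEpsAlpha ε (1 / 2)
          ∉ ({p : TriCorr | ATOBL_left p} ∪ {p : TriCorr | ATOBL_right p}) := by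
    rintro ε ⟨h, h1⟩
    refine ⟨pEpsAlpha_half_mem_convexHull (by linarith) h1, ?_⟩
    rintro (hl | hr)
    · exact not_ATOBL_left_pEpsAlpha_half (by linarith) hl
    · exact not_ATOBL_right_pEpsAlpha_half (by linarith) hr
  have h1 := key 1 ⟨by norm_num, le_rfl⟩
  exact ⟨⟨subset_convexHull ℝ _, fun h => h1.2 (h h1.1)⟩, key⟩
end
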